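/- (Bigelow, Krammer) For every n ≥ 2 the braid group B_n is linear: there exists an injective group homomorphism from B_n into the general linear group GL_m(ℂ) of invertible m × m complex matrices, where m = n(n−1)/2. -/

import Mathlib

/-- The set of relators for Artin's classical presentation of the braid group `Bₙ`:
generators `σ₁, …, σ_{n-1}` (indexed by `Fin (n-1)`), with relations
`σᵢ σₖ = σₖ σᵢ` when `|i - k| ≥ 2` and `σᵢ σ_{i+1} σᵢ = σ_{i+1} σᵢ σ_{i+1}`. -/
def braidRels (n : ℕ) : Set (FreeGroup (Fin (n - 1))) :=
  {w | (∃ i k : Fin (n - 1), (i : ℕ) + 2 ≤ (k : ℕ) ∧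
          w = FreeGroup.of i * FreeGroup.of k * (FreeGroup.of k * FreeGroup.of i)⁻¹) ∨
       (∃ i k : Fin (n - 1), (i : ℕ) + 1 = (k : ℕ) ∧
          w = FreeGroup.of i * FreeGroup.of k * FreeGroup.of i *
              (FreeGroup.of k * FreeGroup.of i * FreeGroup.of k)⁻¹)}

/-- The braid group `Bₙ`, given by Artin's classical presentation. -/
abbrev BraidGroup (n : ℕ) : Type := PresentedGroup (braidRels n)

/-- One Artin generator `σ_k` in the (dual) Lawrence–Krammer representation, acting on functions of
pairs `i < j`; the value at other pairs is irrelevant. -/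
def krammerStep {R : Type*} [CommRing R] (q t : R) (k : ℕ) (F : ℕ → ℕ → R) (i j : ℕ) : R :=
  if j = k then (1 - q) * F i k + q * F i (k + 1)
  else if i = k + 1 then q * F k j + (1 - q) * F (k + 1) j
  else if i = k then
    if j = k + 1 then t * q ^ 2 * F k (k + 1)
    else F (k + 1) j + t * q * (q - 1) * F k (k + 1)
  else if j = k + 1 then F i k + t * q * (q - 1) * F k (k + 1)
  else if i < k ∧ k + 1 < j then F i j + t * (q - 1) ^ 2 * F k (k + 1)
  else F i j

theorem krammerStep_comm {R : Type*} [CommRing R] (q t : R) {k l : ℕ} (hkl : k + 2 ≤ l)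
    (F : ℕ → ℕ → R) {i j : ℕ} (hij : i < j) :
    krammerStep q t k (krammerStep q t l F) i j = krammerStep q t l (krammerStep q t k F) i j := by
  have hi : i < k ∨ i = k ∨ i = k + 1 ∨ (k + 1 < i ∧ i < l) ∨ i = l ∨ i = l + 1 ∨ l + 1 < i := by
    omega
  have hj : j < k ∨ j = k ∨ j = k + 1 ∨ (k + 1 < j ∧ j < l) ∨ j = l ∨ j = l + 1 ∨ l + 1 < j := by
    omega
  rcases hi with hi | hi | hi | hi | hi | hi | hi <;>
  rcases hj with hj | hj | hj | hj | hj | hj | hj <;>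
  first
  | (exfalso; omega)
  | (subst_vars
     simp (disch := omega) only [krammerStep, ↓if_pos, ↓if_neg] <;> ring)

theorem krammerStep_braid {R : Type*} [CommRing R] (q t : R) (k : ℕ) (F : ℕ → ℕ → R)
    {i j : ℕ} (hij : i < j) :
    krammerStep q t k (krammerStep q t (k + 1) (krammerStep q t k F)) i j =
      krammerStep q t (k + 1) (krammerStep q t k (krammerStep q t (k + 1) F)) i j := by
  have hi : i < k ∨ i = k ∨ i = k + 1 ∨ i = k + 2 ∨ k + 2 < i := by omega
  have hj : j < k ∨ j = k ∨ j = k + 1 ∨ j = k + 2 ∨ k + 2 < j := by omega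
  rcases hi with hi | hi | hi | hi | hi <;>
  rcases hj with hj | hj | hj | hj | hj <;>
  first
  | (exfalso; omega)
  | (subst_vars
     simp (disch := omega) only [krammerStep, ↓if_pos, ↓if_neg] <;> ring)

theorem krammerStep_congr {R : Type*} [CommRing R] (q t : R) {n k : ℕ} (hk : k + 1 < n)
    {F G : ℕ → ℕ → R} (h : ∀ i j, i < j → j < n → F i j = G i j) {i j : ℕ} (hij : i < j)
    (hj : j < n) : krammerStep q t k F i j = krammerStep q t k G i j := by
  unfold krammerStep
  grind

theorem krammerStep_map {R S : Type*} [CommRing R] [CommRing S] (φ : R →+* S) (q t : R) (k : ℕ)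
    (F : ℕ → ℕ → R) (i j : ℕ) :
    φ (krammerStep q t k F i j) = krammerStep (φ q) (φ t) k (fun a b => φ (F a b)) i j := by
  unfold krammerStep
  split_ifs <;> simp

/-- The index set of the Lawrence–Krammer representation: pairs `i < j < n`, listed by `j`. -/
abbrev KrammerIndex (n : ℕ) : Type := (j : Fin n) × Fin j

theorem card_krammerIndex (n : ℕ) : Fintype.card (KrammerIndex n) = n * (n - 1) / 2 := by
  rw [Fintype.card_sigma]
  simp only [Fintype.card_fin]
  rw [Fin.sum_univ_eq_sum_range (fun i => i) n, Finset.sum_range_id]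

/-- Extension by zero of a function of pairs `i < j < n`. -/
def extendPairs {R : Type*} [Zero R] {n : ℕ} (f : KrammerIndex n → R) (i j : ℕ) : R :=
  if h : j < n ∧ i < j then f ⟨⟨j, h.1⟩, ⟨i, h.2⟩⟩ else 0

theorem extendPairs_apply {R : Type*} [Zero R] {n : ℕ} (f : KrammerIndex n → R) {i j : ℕ}
    (hij : i < j) (hj : j < n) : extendPairs f i j = f ⟨⟨j, hj⟩, ⟨i, hij⟩⟩ :=
  dif_pos ⟨hj, hij⟩

/-- The operator of the generator `σ_k` in the Lawrence–Krammer representation. -/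
def krammerMap {R : Type*} [CommRing R] (q t : R) (n k : ℕ) :
    Module.End R (KrammerIndex n → R) where
  toFun f p := krammerStep q t k (extendPairs f) p.2 p.1
  map_add' f g := by
    have h : extendPairs (f + g) = fun i j => extendPairs f i j + extendPairs g i j := by
      funext i j
      unfold extendPairs
      split_ifs <;> simp
    funext p
    simp only [h, Pi.add_apply, krammerStep]
    split_ifs <;> ring
  map_smul' c f := by
    have h : extendPairs (c • f) = fun i j => c * extendPairs f i j := by
      funext i j
      unfold extendPairs
      split_ifs <;> simp
    funext p
    simp only [h, Pi.smul_apply, smul_eq_mul, RingHom.id_apply, krammerStep]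
    split_ifs <;> ring

section KrammerMap

variable {R : Type*} [CommRing R] (q t : R) {n : ℕ}

theorem krammerMap_apply (k : ℕ) (f : KrammerIndex n → R) (p : KrammerIndex n) :
    krammerMap q t n k f p = krammerStep q t k (extendPairs f) p.2 p.1 := rfl

theorem extendPairs_krammerMap (k : ℕ) (f : KrammerIndex n → R) {i j : ℕ} (hij : i < j)
    (hj : j < n) :
    extendPairs (krammerMap q t n k f) i j = krammerStep q t k (extendPairs f) i j := by
  rw [extendPairs_apply _ hij hj, krammerMap_apply]

theorem krammerMap_krammerMap_apply {k : ℕ} (hk : k + 1 < n) (l : ℕ) (f : KrammerIndex n → R)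
    (p : KrammerIndex n) : krammerMap q t n k (krammerMap q t n l f) p =
      krammerStep q t k (krammerStep q t l (extendPairs f)) p.2 p.1 :=
  krammerStep_congr q t hk (fun _ _ hij hj => extendPairs_krammerMap q t l f hij hj)
    p.2.isLt p.1.isLt

theorem krammerMap_comm {k l : ℕ} (hkl : k + 2 ≤ l) (hl : l + 1 < n) :
    krammerMap q t n k * krammerMap q t n l = krammerMap q t n l * krammerMap q t n k := by
  refine LinearMap.ext fun f => funext fun p => ?_
  rw [Module.End.mul_apply, Module.End.mul_apply, krammerMap_krammerMap_apply q t (by omega),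
    krammerMap_krammerMap_apply q t hl, krammerStep_comm q t hkl _ p.2.isLt]

theorem krammerMap_braid {k : ℕ} (hk : k + 2 < n) :
    krammerMap q t n k * krammerMap q t n (k + 1) * krammerMap q t n k =
      krammerMap q t n (k + 1) * krammerMap q t n k * krammerMap q t n (k + 1) := by
  have h3 : ∀ a b c, a + 1 < n → b + 1 < n → ∀ (f : KrammerIndex n → R) (p : KrammerIndex n),
      (krammerMap q t n a * krammerMap q t n b * krammerMap q t n c) f p =
        krammerStep q t a (krammerStep q t b (krammerStep q t c (extendPairs f))) p.2 p.1 := by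
    intro a b c ha hb f p
    rw [mul_assoc, Module.End.mul_apply, krammerMap_apply]
    refine krammerStep_congr q t ha (fun i j hij hj => ?_) p.2.isLt p.1.isLt
    rw [extendPairs_apply _ hij hj, Module.End.mul_apply, krammerMap_krammerMap_apply q t hb]
  refine LinearMap.ext fun f => funext fun p => ?_
  rw [h3 _ _ _ (by omega) (by omega), h3 _ _ _ (by omega) (by omega),
    krammerStep_braid q t k _ p.2.isLt]

theorem krammerMap_naturality {S : Type*} [CommRing S] (φ : R →+* S) (k : ℕ)
    (f : KrammerIndex n → R) :
    φ ∘ krammerMap q t n k f = krammerMap (φ q) (φ t) n k (φ ∘ f) := by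
  funext p
  have h : extendPairs (φ ∘ f) = fun i j => φ (extendPairs f i j) := by
    funext i j
    unfold extendPairs
    split_ifs <;> simp
  rw [Function.comp_apply, krammerMap_apply, krammerMap_apply, krammerStep_map, h]

/-- The product of the operators of a positive word, read from right to left. -/
def krammerWord (n : ℕ) : List (Fin (n - 1)) → Module.End R (KrammerIndex n → R)
  | [] => 1
  | i :: w => krammerWord n w * krammerMap q t n i

theorem krammerWord_naturality {S : Type*} [CommRing S] (φ : R →+* S) (w : List (Fin (n - 1)))
    (f : KrammerIndex n → R) :
    φ ∘ krammerWord q t n w f = krammerWord (φ q) (φ t) n w (φ ∘ f) := by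
  induction w generalizing f with
  | nil => rfl
  | cons i w ih =>
    simp only [krammerWord, Module.End.mul_apply]
    rw [ih, krammerMap_naturality]

end KrammerMap

theorem krammerMap_injective {K : Type*} [Field K] {q t : K} (hq : q ≠ 0) (ht : t ≠ 0) {n k : ℕ}
    (hk : k + 1 < n) : Function.Injective (krammerMap q t n k) := by
  rw [injective_iff_map_eq_zero]
  intro f hf
  have h : ∀ i j, i < j → j < n → krammerStep q t k (extendPairs f) i j = 0 := by
    intro i j hij hj
    rw [← extendPairs_krammerMap q t k f hij hj, hf, extendPairs_apply _ hij hj, Pi.zero_apply]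
  have h0 : extendPairs f k (k + 1) = 0 := by
    have := h k (k + 1) (by omega) hk
    simpa [krammerStep, hq, ht] using this
  have key : ∀ i j, i < j → j < n → extendPairs f i j = 0 := by
    intro i j hij hj
    have hleft : ∀ i, i < k → extendPairs f i k = 0 := by
      intro i hi
      have := h i (k + 1) (by omega) hk
      simpa (disch := omega) [krammerStep, if_pos, if_neg, h0, hi.ne] using this
    have hright : ∀ j, k + 1 < j → j < n → extendPairs f (k + 1) j = 0 := by
      intro j hj hjn
      have := h k j (by omega) hjn
      simpa (disch := omega) [krammerStep, if_pos, if_neg, h0] using this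
    by_cases h1 : i = k ∧ j = k + 1
    · rw [h1.1, h1.2, h0]
    by_cases h2 : j = k
    · subst h2; exact hleft i hij
    by_cases h3 : i = k + 1
    · subst h3; exact hright j hij hj
    by_cases h4 : j = k + 1
    · have := h i k (by omega) (by omega)
      rw [krammerStep, if_pos rfl, hleft i (by omega), h4] at *
      simpa [hq] using this
    by_cases h5 : i = k
    · have := h (k + 1) j (by omega) hj
      rw [krammerStep, if_neg h2, if_pos rfl, hright j (by omega) hj, h5] at *
      simpa [hq] using this
    · have := h i j hij hj
      simpa [krammerStep, h2, h3, h4, h5, h0] using this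
  funext p
  rw [← extendPairs_apply f p.2.isLt p.1.isLt, key _ _ p.2.isLt p.1.isLt, Pi.zero_apply]

theorem krammerMap_nonneg {n k : ℕ} {f : KrammerIndex n → ℚ} (hf : 0 ≤ f) :
    0 ≤ krammerMap (1 / 2 : ℚ) 0 n k f := by
  have h : ∀ i j, 0 ≤ extendPairs f i j := by
    intro i j
    unfold extendPairs
    split_ifs
    · exact hf _
    · exact le_rfl
  intro p
  simp only [krammerMap_apply, krammerStep, Pi.zero_apply]
  split_ifs <;> norm_num <;>
    first
    | exact h _ _
    | linarith [h p.2 k, h p.2 (k + 1), h k p.1, h (k + 1) p.1]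

theorem krammerWord_nonneg {n : ℕ} (w : List (Fin (n - 1))) {f : KrammerIndex n → ℚ}
    (hf : 0 ≤ f) : 0 ≤ krammerWord (1 / 2 : ℚ) 0 n w f := by
  induction w generalizing f with
  | nil => exact hf
  | cons i w ih => exact ih (krammerMap_nonneg hf)

theorem krammerWord_eq_zero_of_le {n : ℕ} {w : List (Fin (n - 1))} {f g : KrammerIndex n → ℚ}
    (hf : 0 ≤ f) (hfg : (1 / 2 : ℚ) • f ≤ g) (hg : krammerWord (1 / 2 : ℚ) 0 n w g = 0) :
    krammerWord (1 / 2 : ℚ) 0 n w f = 0 := by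
  have h := krammerWord_nonneg w (sub_nonneg.mpr hfg)
  rw [map_sub, hg, map_smul] at h
  refine le_antisymm (fun p => ?_) (krammerWord_nonneg w hf)
  have := h p
  simp only [Pi.zero_apply, Pi.sub_apply, Pi.smul_apply, smul_eq_mul] at this ⊢
  linarith

/-- The indicator function of the pair `(k, k + 1)`. -/
def simplePair (n k : ℕ) (p : KrammerIndex n) : ℚ :=
  if (p.2 : ℕ) = k ∧ (p.1 : ℕ) = k + 1 then 1 else 0

theorem extendPairs_simplePair {n k : ℕ} (hk : k + 1 < n) :
    extendPairs (simplePair n k) = fun i j => if i = k ∧ j = k + 1 then 1 else 0 := by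
  funext i j
  unfold extendPairs simplePair
  grind

theorem simplePair_nonneg (n k : ℕ) : 0 ≤ simplePair n k := by
  intro p
  unfold simplePair
  split_ifs <;> simp

theorem simplePair_ne_zero {n k : ℕ} (hk : k + 1 < n) : simplePair n k ≠ 0 := by
  intro h
  have := congrFun h ⟨⟨k + 1, hk⟩, ⟨k, k.lt_succ_self⟩⟩
  simp [simplePair] at this

theorem krammerMap_simplePair_self {n k : ℕ} (hk : k + 1 < n) :
    krammerMap (1 / 2 : ℚ) 0 n k (simplePair n k) = 0 := by
  funext p
  have := p.2.isLt
  rw [krammerMap_apply, extendPairs_simplePair hk, Pi.zero_apply]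
  unfold krammerStep
  grind

theorem le_krammerMap_simplePair {n k l : ℕ} (hk : k + 1 < n) (hkl : l ≠ k) :
    (1 / 2 : ℚ) • simplePair n k ≤ krammerMap (1 / 2 : ℚ) 0 n l (simplePair n k) := by
  intro p
  by_cases hp : (p.2 : ℕ) = k ∧ (p.1 : ℕ) = k + 1
  · rw [krammerMap_apply, extendPairs_simplePair hk, Pi.smul_apply, simplePair, if_pos hp, hp.1,
      hp.2, smul_eq_mul]
    unfold krammerStep
    grind
  · rw [Pi.smul_apply, simplePair, if_neg hp, smul_zero]
    exact krammerMap_nonneg (simplePair_nonneg n k) p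

theorem le_krammerMap_krammerMap_simplePair {n k l : ℕ} (hk : k + 1 < n) (hl : l + 1 < n)
    (hkl : k = l + 1 ∨ l = k + 1) : (1 / 2 : ℚ) • simplePair n l ≤
      krammerMap (1 / 2 : ℚ) 0 n k (krammerMap (1 / 2 : ℚ) 0 n l (simplePair n k)) := by
  intro p
  by_cases hp : (p.2 : ℕ) = l ∧ (p.1 : ℕ) = l + 1
  · rw [krammerMap_krammerMap_apply _ _ hk, extendPairs_simplePair hk, Pi.smul_apply, simplePair,
      if_pos hp, hp.1, hp.2]
    rcases hkl with rfl | rfl <;> simp (disch := omega) [krammerStep, if_neg]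
  · rw [Pi.smul_apply, simplePair, if_neg hp, smul_zero]
    exact krammerMap_nonneg (krammerMap_nonneg (simplePair_nonneg n k)) p

open Polynomial in
/-- An identity between two positive words over a transcendental parameter survives the
specialization of that parameter to `0`. -/
theorem krammerWord_specialize {K : Type*} [Field K] [Algebra ℚ K] {t : K}
    (ht : Transcendental ℚ t) {n : ℕ} {w w' : List (Fin (n - 1))}
    (h : krammerWord (algebraMap ℚ K (1 / 2)) t n w = krammerWord (algebraMap ℚ K (1 / 2)) t n w') :
    krammerWord (1 / 2 : ℚ) 0 n w = krammerWord (1 / 2 : ℚ) 0 n w' := by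
  have hX : ∀ f : KrammerIndex n → ℚ[X],
      krammerWord (C (1 / 2)) X n w f = krammerWord (C (1 / 2)) X n w' f := by
    intro f
    have hinj : Function.Injective (aeval t : ℚ[X] →ₐ[ℚ] K) :=
      transcendental_iff_injective.mp ht
    apply hinj.comp_left
    have key := fun v => krammerWord_naturality (C (1 / 2)) X
      (aeval t : ℚ[X] →ₐ[ℚ] K).toRingHom v f
    have e1 : (aeval t : ℚ[X] →ₐ[ℚ] K).toRingHom (C (1 / 2)) = algebraMap ℚ K (1 / 2) :=
      aeval_C t _
    have e2 : (aeval t : ℚ[X] →ₐ[ℚ] K).toRingHom X = t := aeval_X t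
    rw [e1, e2] at key
    exact (key w).trans (h ▸ (key w').symm)
  refine LinearMap.ext fun f => ?_
  have key := fun v => krammerWord_naturality (C (1 / 2)) X (evalRingHom (0 : ℚ)) v (C ∘ f)
  have hf : evalRingHom (0 : ℚ) ∘ C ∘ f = f := by
    funext p
    simp
  have e1 : evalRingHom (0 : ℚ) (C (1 / 2)) = 1 / 2 := by simp
  have e2 : evalRingHom (0 : ℚ) X = 0 := by simp
  rw [hf, e1, e2] at key
  rw [← key w, ← key w', hX]

section GarsideElement

variable {G : Type*} [Group G]

/-- The product `s 0 * s 1 * ⋯ * s (k - 1)`. -/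
def ascendingProd (s : ℕ → G) : ℕ → G
  | 0 => 1
  | k + 1 => ascendingProd s k * s k

/-- Garside's half twist on the generators `s 0, …, s (k - 1)`. -/
def halfTwist (s : ℕ → G) : ℕ → G
  | 0 => 1
  | k + 1 => ascendingProd s (k + 1) * halfTwist s k

/-- The sequence `s` satisfies Artin's relations on its first `N` members. -/
structure ArtinRelations (s : ℕ → G) (N : ℕ) : Prop where
  comm : ∀ i j, i + 2 ≤ j → j < N → s i * s j = s j * s i
  braid : ∀ i, i + 1 < N → s i * s (i + 1) * s i = s (i + 1) * s i * s (i + 1)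

namespace ArtinRelations

variable {s : ℕ → G} {N : ℕ} (h : ArtinRelations s N)
include h

theorem commute_ascendingProd {k j : ℕ} (hkj : k + 1 ≤ j) (hj : j < N) :
    Commute (ascendingProd s k) (s j) := by
  induction k with
  | zero => exact Commute.one_left _
  | succ k ih => exact (ih (by omega)).mul_left (h.comm k j (by omega) hj)

theorem commute_halfTwist {k j : ℕ} (hkj : k + 1 ≤ j) (hj : j < N) :
    Commute (halfTwist s k) (s j) := by
  induction k with
  | zero => exact Commute.one_left _
  | succ k ih => exact (h.commute_ascendingProd hkj hj).mul_left (ih (by omega))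

theorem ascendingProd_mul {k i : ℕ} (hi : i + 1 < k) (hk : k ≤ N) :
    ascendingProd s k * s i = s (i + 1) * ascendingProd s k := by
  induction k with
  | zero => omega
  | succ k ih =>
    rcases Nat.lt_or_ge (i + 1) k with hik | hik
    · rw [ascendingProd, mul_assoc, ← h.comm i k (by omega) (by omega), ← mul_assoc,
        ih hik (by omega), mul_assoc]
    · obtain rfl : k = i + 1 := by omega
      have hc := (h.commute_ascendingProd (le_refl (i + 1)) (by omega)).eq
      calc ascendingProd s i * s i * s (i + 1) * s i
          = ascendingProd s i * (s i * s (i + 1) * s i) := by group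
        _ = ascendingProd s i * s (i + 1) * (s i * s (i + 1)) := by
            rw [h.braid i (by omega)]; group
        _ = s (i + 1) * (ascendingProd s i * s i * s (i + 1)) := by rw [hc]; group

theorem mul_ascendingProd_mul_ascendingProd {k j : ℕ} (hj : j < k) (hk : k ≤ N) :
    s 0 * ascendingProd s k * ascendingProd s j = ascendingProd s (j + 1) * ascendingProd s k := by
  induction j with
  | zero => simp [ascendingProd]
  | succ j ih =>
    rw [ascendingProd, ← mul_assoc, ih (by omega), mul_assoc, h.ascendingProd_mul hj hk,
      ← mul_assoc]
    rfl

theorem halfTwist_mul {k i j : ℕ} (hij : i + j + 1 = k) (hk : k ≤ N) :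
    halfTwist s k * s i = s j * halfTwist s k := by
  induction k generalizing i j with
  | zero => omega
  | succ k ih =>
    rcases j with _ | j
    · obtain rfl : i = k := by omega
      rcases i with _ | m
      · simp [halfTwist, ascendingProd]
      · have hc := (h.commute_halfTwist (le_refl (m + 1)) (by omega)).eq
        have hA := h.mul_ascendingProd_mul_ascendingProd (Nat.lt_succ_self (m + 1)) hk
        calc ascendingProd s (m + 2) * (ascendingProd s (m + 1) * halfTwist s m) * s (m + 1)
            = ascendingProd s (m + 2) * ascendingProd s (m + 1) *
                (halfTwist s m * s (m + 1)) := by group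
          _ = ascendingProd s (m + 2) * (ascendingProd s (m + 1) * s (m + 1)) *
                halfTwist s m := by rw [hc]; group
          _ = s 0 * ascendingProd s (m + 2) * ascendingProd s (m + 1) * halfTwist s m := by
              rw [hA]; rfl
          _ = s 0 * (ascendingProd s (m + 2) * (ascendingProd s (m + 1) * halfTwist s m)) := by
              group
    · rw [halfTwist, mul_assoc, ih (j := j) (by omega) (by omega), ← mul_assoc,
        h.ascendingProd_mul (by omega) hk, mul_assoc]

omit h in
theorem ascendingProd_mem {k : ℕ} (hk : k ≤ N) :
    ascendingProd s k ∈ Submonoid.closure (s '' Set.Iio N) := by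
  induction k with
  | zero => exact one_mem _
  | succ k ih =>
    exact mul_mem (ih (by omega)) (Submonoid.subset_closure ⟨k, Set.mem_Iio.mpr (by omega), rfl⟩)

omit h in
theorem halfTwist_mem {k : ℕ} (hk : k ≤ N) :
    halfTwist s k ∈ Submonoid.closure (s '' Set.Iio N) := by
  induction k with
  | zero => exact one_mem _
  | succ k ih => exact mul_mem (ascendingProd_mem hk) (ih (by omega))

omit h in
theorem exists_ascendingProd_eq {k : ℕ} (hk : k + 1 ≤ N) :
    ∃ r ∈ Submonoid.closure (s '' Set.Iio N), ascendingProd s (k + 1) = s 0 * r := by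
  induction k with
  | zero => exact ⟨1, one_mem _, by simp [ascendingProd]⟩
  | succ k ih =>
    obtain ⟨r, hr, e⟩ := ih (by omega)
    refine ⟨r * s (k + 1), mul_mem hr (Submonoid.subset_closure ⟨k + 1, hk, rfl⟩), ?_⟩
    rw [ascendingProd, e, mul_assoc]

theorem exists_halfTwist_eq {k i : ℕ} (hi : i < k) (hk : k ≤ N) :
    ∃ r ∈ Submonoid.closure (s '' Set.Iio N), halfTwist s k = s i * r := by
  induction k generalizing i with
  | zero => omega
  | succ k ih =>
    rcases i with _ | i
    · obtain ⟨r, hr, e⟩ := exists_ascendingProd_eq (s := s) hk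
      exact ⟨r * halfTwist s k, mul_mem hr (halfTwist_mem (by omega)), by
        rw [halfTwist, e, mul_assoc]⟩
    · obtain ⟨r, hr, e⟩ := ih (i := i) (by omega) (by omega)
      refine ⟨ascendingProd s (k + 1) * r, mul_mem (ascendingProd_mem hk) hr, ?_⟩
      rw [halfTwist, e, ← mul_assoc, h.ascendingProd_mul hi hk, mul_assoc]

theorem exists_mul_halfTwist_eq {p : G} (hp : p ∈ Submonoid.closure (s '' Set.Iio N)) :
    ∃ r ∈ Submonoid.closure (s '' Set.Iio N), p * halfTwist s N = halfTwist s N * r := by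
  induction hp using Submonoid.closure_induction with
  | mem x hx =>
    obtain ⟨i, hi, rfl⟩ := hx
    have hi' : i < N := hi
    refine ⟨s (N - 1 - i), Submonoid.subset_closure ⟨_, Set.mem_Iio.mpr (by omega), rfl⟩, ?_⟩
    exact (h.halfTwist_mul (by omega) le_rfl).symm
  | one => exact ⟨1, one_mem _, by simp⟩
  | mul x y _ _ hx hy =>
    obtain ⟨r, hr, e⟩ := hx
    obtain ⟨r', hr', e'⟩ := hy
    exact ⟨r * r', mul_mem hr hr', by rw [mul_assoc, e', ← mul_assoc, e, mul_assoc]⟩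

/-- Every element of the group generated by the `s i` is a fraction of positive elements. -/
theorem exists_eq_mul_inv {g : G} (hg : g ∈ Subgroup.closure (s '' Set.Iio N)) :
    ∃ p ∈ Submonoid.closure (s '' Set.Iio N), ∃ r ∈ Submonoid.closure (s '' Set.Iio N),
      g = p * r⁻¹ := by
  induction hg using Subgroup.closure_induction_left with
  | one => exact ⟨1, one_mem _, 1, one_mem _, by simp⟩
  | mul_left x hx y _ ih =>
    obtain ⟨p, hp, r, hr, rfl⟩ := ih
    exact ⟨x * p, mul_mem (Submonoid.subset_closure hx) hp, r, hr, (mul_assoc _ _ _).symm⟩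
  | inv_mul_cancel x hx y _ ih =>
    obtain ⟨p, hp, r, hr, rfl⟩ := ih
    obtain ⟨i, hi, rfl⟩ := hx
    obtain ⟨p', hp', e⟩ := h.exists_mul_halfTwist_eq hp
    obtain ⟨c, hc, e'⟩ := h.exists_halfTwist_eq hi le_rfl
    refine ⟨c * p', mul_mem hc hp', r * halfTwist s N, mul_mem hr (halfTwist_mem le_rfl), ?_⟩
    have e'' : p = s i * (c * p') * (halfTwist s N)⁻¹ := by
      rw [← mul_assoc, ← e', ← e, mul_inv_cancel_right]
    rw [e'']
    group

end ArtinRelations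

end GarsideElement

namespace BraidGroup

variable {n : ℕ}

/-- The Artin generator `σ_i` of the braid group. -/
def gen (i : Fin (n - 1)) : BraidGroup n := PresentedGroup.of i

theorem gen_comm {i k : Fin (n - 1)} (h : (i : ℕ) + 2 ≤ k) :
    (gen i : BraidGroup n) * gen k = gen k * gen i := by
  have := PresentedGroup.one_of_mem (rels := braidRels n) (Or.inl ⟨i, k, h, rfl⟩)
  rw [map_mul, map_inv, mul_inv_eq_one, map_mul, map_mul] at this
  exact this

theorem gen_braid {i k : Fin (n - 1)} (h : (i : ℕ) + 1 = k) :
    (gen i : BraidGroup n) * gen k * gen i = gen k * gen i * gen k := by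
  have := PresentedGroup.one_of_mem (rels := braidRels n) (Or.inr ⟨i, k, h, rfl⟩)
  rw [map_mul, map_inv, mul_inv_eq_one, map_mul, map_mul, map_mul, map_mul] at this
  exact this

/-- The positive braid of a word, read from right to left. -/
def ofWord : List (Fin (n - 1)) → BraidGroup n
  | [] => 1
  | i :: w => ofWord w * gen i

theorem exists_ofWord_eq {p : BraidGroup n} (hp : p ∈ Submonoid.closure (Set.range gen)) :
    ∃ w, ofWord w = p := by
  induction hp using Submonoid.closure_induction_right with
  | one => exact ⟨[], rfl⟩
  | mul_right x _ y hy ih =>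
    obtain ⟨w, rfl⟩ := ih
    obtain ⟨i, rfl⟩ := hy
    exact ⟨i :: w, rfl⟩

theorem exists_eq_ofWord_mul_inv (g : BraidGroup n) :
    ∃ w w' : List (Fin (n - 1)), g = ofWord w * (ofWord w')⁻¹ := by
  let s : ℕ → BraidGroup n := fun i => if h : i < n - 1 then gen ⟨i, h⟩ else 1
  have hs : ∀ {i : ℕ} (h : i < n - 1), s i = gen ⟨i, h⟩ := fun h => dif_pos h
  have hrel : ArtinRelations s (n - 1) := by
    constructor
    · intro i j hij hj
      rw [hs hj, hs (show i < n - 1 by omega)]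
      exact gen_comm hij
    · intro i hi
      rw [hs hi, hs (show i < n - 1 by omega)]
      exact gen_braid rfl
  have hrange : s '' Set.Iio (n - 1) = Set.range gen := by
    ext x
    constructor
    · rintro ⟨i, hi, rfl⟩
      exact ⟨⟨i, hi⟩, (hs hi).symm⟩
    · rintro ⟨i, rfl⟩
      exact ⟨i, i.isLt, hs i.isLt⟩
  have hg : g ∈ Subgroup.closure (s '' Set.Iio (n - 1)) := by
    rw [hrange]
    exact (PresentedGroup.closure_range_of (braidRels n)).symm ▸ Subgroup.mem_top g
  obtain ⟨p, hp, r, hr, rfl⟩ := hrel.exists_eq_mul_inv hg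
  rw [hrange] at hp hr
  obtain ⟨w, rfl⟩ := exists_ofWord_eq hp
  obtain ⟨w', rfl⟩ := exists_ofWord_eq hr
  exact ⟨w, w', rfl⟩

section Representation

variable {K : Type*} [Field K] {q t : K} (hq : q ≠ 0) (ht : t ≠ 0)

/-- The invertible operator of an Artin generator. -/
noncomputable def krammerUnit (i : Fin (n - 1)) : (Module.End K (KrammerIndex n → K))ˣ :=
  ((LinearMap.isUnit_iff_ker_eq_bot _).mpr (LinearMap.ker_eq_bot.mpr
    (krammerMap_injective hq ht (n := n) (k := i) (by omega)))).unit

theorem val_krammerUnit (i : Fin (n - 1)) :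
    (krammerUnit hq ht i : Module.End K (KrammerIndex n → K)) = krammerMap q t n i := rfl

/-- The Lawrence–Krammer representation over a field, at nonzero parameters. -/
noncomputable def krammerRep : BraidGroup n →* (Module.End K (KrammerIndex n → K))ˣ :=
  PresentedGroup.toGroup (f := krammerUnit hq ht) (by
    rintro _ (⟨i, k, h, rfl⟩ | ⟨i, k, h, rfl⟩)
    · rw [map_mul, map_inv, mul_inv_eq_one]
      simp only [map_mul, FreeGroup.lift_apply_of]
      exact Units.ext (krammerMap_comm q t h (by omega))
    · rw [map_mul, map_inv, mul_inv_eq_one]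
      simp only [map_mul, FreeGroup.lift_apply_of]
      refine Units.ext ?_
      simp only [Units.val_mul, val_krammerUnit, ← h]
      exact krammerMap_braid q t (by omega))

theorem krammerRep_ofWord (w : List (Fin (n - 1))) :
    (krammerRep hq ht (ofWord w) : Module.End K (KrammerIndex n → K)) = krammerWord q t n w := by
  induction w with
  | nil => simp [ofWord, krammerWord]
  | cons i w ih =>
    have hi : krammerRep hq ht (gen i) = krammerUnit hq ht i := PresentedGroup.toGroup.of _
    rw [ofWord, krammerWord, map_mul, Units.val_mul, ih, hi, val_krammerUnit]

end Representation

section Faithful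

variable {K : Type*} [Field K] [Algebra ℚ K] {t : K} (hq : algebraMap ℚ K (1 / 2) ≠ 0)
  (ht : Transcendental ℚ t) (ht0 : t ≠ 0)
include hq ht ht0

theorem krammerWord_eq_of_krammerRep_eq {w w' : List (Fin (n - 1))}
    (h : krammerRep hq ht0 (ofWord w) = krammerRep hq ht0 (ofWord w')) :
    krammerWord (1 / 2 : ℚ) 0 n w = krammerWord (1 / 2 : ℚ) 0 n w' := by
  refine krammerWord_specialize ht ?_
  rw [← krammerRep_ofWord hq ht0, ← krammerRep_ofWord hq ht0, h]

/-- The specialized representation detects right divisibility of positive braids by the Artin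
generators. -/
theorem exists_ofWord_eq_mul_gen (w : List (Fin (n - 1))) (i : Fin (n - 1))
    (h : krammerWord (1 / 2 : ℚ) 0 n w (simplePair n i) = 0) :
    ∃ w' : List (Fin (n - 1)), w'.length + 1 = w.length ∧ ofWord w = ofWord w' * gen i := by
  induction hl : w.length using Nat.strong_induction_on generalizing w i with
  | _ ℓ ih =>
  subst hl
  rcases w with _ | ⟨j, w⟩
  · exact absurd h (simplePair_ne_zero (by omega))
  by_cases hji : j = i
  · subst hji
    exact ⟨w, rfl, rfl⟩
  have hne : (j : ℕ) ≠ i := fun e => hji (Fin.ext e)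
  have h1 : krammerWord (1 / 2 : ℚ) 0 n w (simplePair n i) = 0 :=
    krammerWord_eq_zero_of_le (simplePair_nonneg n i)
      (le_krammerMap_simplePair (by omega) hne) h
  obtain ⟨v, hv, e⟩ := ih _ (by simp) w i h1 rfl
  by_cases hadj : (i : ℕ) = j + 1 ∨ (j : ℕ) = i + 1
  · have e1 : ofWord (j :: w) = ofWord (j :: i :: v) := by rw [ofWord, e]; rfl
    rw [krammerWord_eq_of_krammerRep_eq hq ht ht0 (congrArg _ e1)] at h
    have h2 : krammerWord (1 / 2 : ℚ) 0 n v (simplePair n j) = 0 :=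
      krammerWord_eq_zero_of_le (simplePair_nonneg n j)
        (le_krammerMap_krammerMap_simplePair (by omega) (by omega) hadj) h
    obtain ⟨u, hu, e2⟩ := ih _ (by simp; omega) v j h2 rfl
    refine ⟨j :: i :: u, by simp; omega, ?_⟩
    have hb : (gen j : BraidGroup n) * gen i * gen j = gen i * gen j * gen i := by
      rcases hadj with hadj | hadj
      · exact gen_braid hadj.symm
      · exact (gen_braid hadj.symm).symm
    rw [ofWord, e, e2, mul_assoc, mul_assoc, ← mul_assoc (gen j), hb]
    simp only [ofWord, mul_assoc]
  · refine ⟨j :: v, by simp [hv], ?_⟩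
    have hc : (gen i : BraidGroup n) * gen j = gen j * gen i := by
      rcases Nat.lt_or_ge i j with hij | hij
      · exact gen_comm (by omega)
      · exact (gen_comm (by omega)).symm
    rw [ofWord, ofWord, e, mul_assoc, hc, mul_assoc]

theorem ofWord_eq_of_krammerRep_eq (w w' : List (Fin (n - 1)))
    (h : krammerRep hq ht0 (ofWord w) = krammerRep hq ht0 (ofWord w')) :
    ofWord w = ofWord w' := by
  have hzero : ∀ (i : Fin (n - 1)) (v : List (Fin (n - 1))),
      krammerWord (1 / 2 : ℚ) 0 n (i :: v) (simplePair n i) = 0 := by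
    intro i v
    rw [krammerWord, Module.End.mul_apply, krammerMap_simplePair_self (by omega), map_zero]
  have hspec := krammerWord_eq_of_krammerRep_eq hq ht ht0 h
  induction w generalizing w' with
  | nil =>
    rcases w' with _ | ⟨i, v⟩
    · rfl
    · have := hzero i v
      rw [← hspec] at this
      exact absurd this (simplePair_ne_zero (by omega))
  | cons i w ih =>
    have h0 := hzero i w
    rw [hspec] at h0
    obtain ⟨v, -, e⟩ := exists_ofWord_eq_mul_gen hq ht ht0 w' i h0
    rw [e, ofWord, map_mul, map_mul, mul_left_inj] at h
    rw [e, ofWord, ih v h (krammerWord_eq_of_krammerRep_eq hq ht ht0 h)]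

theorem krammerRep_injective : Function.Injective (krammerRep (n := n) hq ht0) := by
  rw [injective_iff_map_eq_one]
  intro g hg
  obtain ⟨w, w', rfl⟩ := exists_eq_ofWord_mul_inv g
  rw [map_mul, map_inv, mul_inv_eq_one] at hg
  rw [ofWord_eq_of_krammerRep_eq hq ht ht0 w w' hg, mul_inv_cancel]

end Faithful

end BraidGroup

/-- (Bigelow, Krammer) The braid group `Bₙ` is linear: it embeds into
`GL_m(ℂ)` with `m = n(n-1)/2`, the dimension of the Lawrence–Krammer representation. -/
theorem braidGroup_linear (n : ℕ) (hn : 2 ≤ n) :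
    ∃ φ : BraidGroup n →* GL (Fin (n * (n - 1) / 2)) ℂ, Function.Injective φ := by
  obtain ⟨t, ht⟩ : ∃ t : ℂ, Transcendental ℚ t := by
    refine ⟨algebraMap ℝ ℂ (liouvilleNumber (2 : ℕ)), ?_⟩
    rw [transcendental_algebraMap_iff (algebraMap ℝ ℂ).injective]
    exact fun h => transcendental_liouvilleNumber le_rfl
      ((IsFractionRing.isAlgebraic_iff ℤ ℚ ℝ).mpr h)
  have ht0 : t ≠ 0 := fun h => ht (h ▸ isAlgebraic_zero)
  have hq : algebraMap ℚ ℂ (1 / 2) ≠ 0 := by simp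
  let e : KrammerIndex n ≃ Fin (n * (n - 1) / 2) := Fintype.equivFinOfCardEq (card_krammerIndex n)
  let b : Module.Basis (Fin (n * (n - 1) / 2)) ℂ (KrammerIndex n → ℂ) :=
    (Pi.basisFun ℂ (KrammerIndex n)).reindex e
  let E : (Module.End ℂ (KrammerIndex n → ℂ))ˣ ≃* GL (Fin (n * (n - 1) / 2)) ℂ :=
    Units.mapEquiv (LinearMap.toMatrixAlgEquiv b).toMulEquiv
  exact ⟨E.toMonoidHom.comp (BraidGroup.krammerRep hq ht0),
    E.injective.comp (BraidGroup.krammerRep_injective hq ht ht0)⟩
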